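/- Let K, L ∈ ℕ with L > K, let α ∈ 𝒞_{K,L} with associated sequence (n_k), and let f(x) = -log x - log(1-x) + g(x) with g ∈ C³(𝕋), g > 0. There exist k₀ ∈ ℕ and b₀ > 0 such that for every k ≥ k₀, every b ≥ b₀ and every i ∈ {−L, −L+1, …, −1, 1, …, L}: A_k(b) ∩ R_α^{i·q_{n_k}}(A_k(b/(2L))) = ∅, where A_k(b) = {x ∈ 𝕋 : |S_{q_{n_k}}(f)(x) − c_k| ≥ b} with x_k = 1/(2q_{n_k}) and c_k = S_{q_{n_k}}(f)(x_k). -/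

import Mathlib

open MeasureTheory Filter Topology

noncomputable section

/-- Iterates of the Gauss map applied to the fractional part of `α`. -/
def gaussIter (α : ℝ) (n : ℕ) : ℝ := (fun x : ℝ => Int.fract x⁻¹)^[n] (Int.fract α)

/-- The `n`-th partial quotient `a_n` of the continued fraction expansion of `α`
(for `n ≥ 1`). -/
def cfA (α : ℝ) (n : ℕ) : ℕ := ⌊(gaussIter α (n - 1))⁻¹⌋₊

/-- The denominators `q_n` of the convergents of the continued fraction of `α`:
`q₀ = 1`, `q₁ = a₁`, `q_{n+1} = a_{n+1} q_n + q_{n-1}`. -/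
def cfQ (α : ℝ) : ℕ → ℕ
  | 0 => 1
  | 1 => cfA α 1
  | n + 2 => cfA α (n + 2) * cfQ α (n + 1) + cfQ α n

/-- Birkhoff sums over the rotation by `α`: `S_n(φ)(x) = ∑_{i<n} φ(x + iα)`. -/
def birkhoffRot (α : ℝ) (φ : ℝ → ℝ) (n : ℕ) (x : ℝ) : ℝ :=
  ∑ i ∈ Finset.range n, φ (x + i * α)

/-- Distance to the nearest integer, `‖x‖ = min(x mod 1, 1 - x mod 1)`. -/
def distNearestInt (x : ℝ) : ℝ := min (Int.fract x) (1 - Int.fract x)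

/-- `h(x) = -log x - log(1-x)`, read on the circle. -/
def symLog (x : ℝ) : ℝ := -Real.log (Int.fract x) - Real.log (1 - Int.fract x)

/-- The roof `f(x) = -log x - log(1-x) + g(x)`, read on the circle. -/
def symLogRoof (g : ℝ → ℝ) (x : ℝ) : ℝ := symLog x + g x

/-- The set `A_k(b) = {x ∈ 𝕋 : |S_q(f)(x) - c_k| ≥ b}` where `q = q_{n_k}` and
`c_k = S_q(f)(x_k)` with `x_k = 1/(2q)` (here `𝕋` is represented by `[0,1)`). -/
def AkSet (α : ℝ) (g : ℝ → ℝ) (q : ℕ) (b : ℝ) : Set ℝ :=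
  {x | x ∈ Set.Ico (0 : ℝ) 1 ∧
    b ≤ |birkhoffRot α (symLogRoof g) q x
          - birkhoffRot α (symLogRoof g) q (1 / (2 * (q : ℝ)))|}

lemma sum_range_emod_affine {Q : ℕ} (hQ : 0 < Q) {P : ℤ} (h : IsCoprime P Q) (t : ℤ)
    (F : ℤ → ℝ) :
    ∑ k ∈ Finset.range Q, F ((P * k + t) % Q) = ∑ k ∈ Finset.range Q, F k := by
  have hQ' : (0 : ℤ) < Q := by exact_mod_cast hQ
  have hnn (k : ℕ) : 0 ≤ (P * k + t) % Q := Int.emod_nonneg _ hQ'.ne'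
  have hmaps : Set.MapsTo (fun k : ℕ => ((P * k + t) % Q).toNat) (Finset.range Q)
      (Finset.range Q) := by
    intro k _
    have := Int.emod_lt_of_pos (P * k + t) hQ'
    have := hnn k
    simp only [Finset.coe_range, Set.mem_Iio]
    omega
  have hinj : Set.InjOn (fun k : ℕ => ((P * k + t) % Q).toNat) (Finset.range Q) := by
    intro k hk l hl hkl
    simp only [Finset.coe_range, Set.mem_Iio] at hk hl hkl
    have h1 : (P * k + t) % Q = (P * l + t) % Q := by
      have := hnn k
      have := hnn l
      omega
    have h2 : (Q : ℤ) ∣ P * ((k : ℤ) - l) := by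
      have := Int.dvd_of_emod_eq_zero (Int.emod_eq_emod_iff_emod_sub_eq_zero.1 h1)
      simpa [mul_sub] using this
    have h3 : (Q : ℤ) ∣ (k : ℤ) - l := h.symm.dvd_of_dvd_mul_left h2
    have h4 := Int.eq_zero_of_abs_lt_dvd h3 (by rw [abs_lt]; constructor <;> omega)
    omega
  refine Finset.sum_nbij (fun k : ℕ => ((P * k + t) % Q).toNat) hmaps hinj
    (Finset.surjOn_of_injOn_of_card_le _ hmaps hinj le_rfl) fun k _ => ?_
  rw [Int.toNat_of_nonneg (hnn k)]

lemma abs_fract_div_sub_le {Q c : ℕ} (hc : c < Q) {σ : ℝ} (h1 : -1 ≤ σ) (h2 : σ < 2) :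
    |Int.fract (((c : ℝ) + σ) / Q) - c / Q| ≤
      2 / Q + (if c = 0 then 1 else 0) + (if c = Q - 1 then 1 else 0) := by
  have hQ : (0 : ℝ) < Q := by exact_mod_cast (by omega : 0 < Q)
  by_cases hb : c = 0 ∨ c = Q - 1
  · have hge : (1 : ℝ) ≤ (if c = 0 then 1 else 0) + (if c = Q - 1 then 1 else 0) := by
      rcases hb with hb | hb
      · rw [if_pos hb]; split_ifs <;> norm_num
      · rw [if_pos hb]; split_ifs <;> norm_num
    have hf0 := Int.fract_nonneg (((c : ℝ) + σ) / Q)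
    have hf1 := Int.fract_lt_one (((c : ℝ) + σ) / Q)
    have hc0 : (0 : ℝ) ≤ c / Q := by positivity
    have hc1 : (c : ℝ) / Q ≤ 1 := by
      rw [div_le_one hQ]; exact_mod_cast hc.le
    have : (0 : ℝ) ≤ 2 / Q := by positivity
    rw [abs_le]; constructor <;> linarith
  · push Not at hb
    rw [if_neg hb.1, if_neg hb.2]
    have hc1 : (1 : ℝ) ≤ c := by exact_mod_cast Nat.one_le_iff_ne_zero.2 hb.1
    have hc2 : (c : ℝ) + 2 ≤ Q := by exact_mod_cast (by omega : c + 2 ≤ Q)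
    have : Int.fract (((c : ℝ) + σ) / Q) = (c + σ) / Q := by
      rw [Int.fract_eq_self]
      constructor
      · apply div_nonneg <;> linarith
      · rw [div_lt_one hQ]; linarith
    rw [this, ← sub_div, add_zero, add_zero, add_sub_cancel_left, abs_div, abs_of_pos hQ]
    gcongr
    rw [abs_le]; constructor <;> linarith

lemma abs_sum_fract_sub_half_le {Q : ℕ} (hQ : 0 < Q) {P : ℤ} (h : IsCoprime P Q) (γ : ℝ)
    (θ : ℕ → ℝ) (hθ : ∀ k < Q, |θ k| ≤ 1 / Q) :
    |∑ k ∈ Finset.range Q, (Int.fract ((P * k : ℝ) / Q + γ + θ k) - 1 / 2)| ≤ 5 := by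
  have hQ' : (0 : ℝ) < Q := by exact_mod_cast hQ
  have hQz : (0 : ℤ) < Q := by exact_mod_cast hQ
  set t : ℤ := ⌊Q * γ⌋ with ht
  set F : ℤ → ℝ := fun c => 2 / Q + (if c = 0 then 1 else 0) + (if c = Q - 1 then 1 else 0)
    with hF
  have hterm : ∀ k ∈ Finset.range Q,
      |Int.fract ((P * k : ℝ) / Q + γ + θ k) - (((P * k + t) % Q : ℤ) : ℝ) / Q| ≤
        F ((P * k + t) % Q) := by
    intro k hk
    obtain ⟨c, hc⟩ := Int.eq_ofNat_of_zero_le (Int.emod_nonneg (P * k + t) hQz.ne')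
    have hcQ : c < Q := by
      have := Int.emod_lt_of_pos (P * k + t) hQz
      omega
    have hθk := abs_le.1 (hθ k (Finset.mem_range.1 hk))
    have hdiv := Int.emod_add_mul_ediv (P * k + t) Q
    set z := (P * k + t) / Q
    have hdiv' : (c : ℝ) + Q * z = P * k + t := by
      rw [hc] at hdiv; exact_mod_cast hdiv
    have hθ1 : -1 ≤ Q * θ k := by
      have := mul_le_mul_of_nonneg_left hθk.1 hQ'.le
      rwa [mul_neg, mul_one_div_cancel hQ'.ne'] at this
    have hθ2 : Q * θ k ≤ 1 := by
      have := mul_le_mul_of_nonneg_left hθk.2 hQ'.le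
      rwa [mul_one_div_cancel hQ'.ne'] at this
    have key := abs_fract_div_sub_le hcQ (σ := Int.fract (Q * γ) + Q * θ k)
      (by linarith [Int.fract_nonneg ((Q : ℝ) * γ)]) (by linarith [Int.fract_lt_one ((Q : ℝ) * γ)])
    have harg : (P * k : ℝ) / Q + γ + θ k = (c + (Int.fract (Q * γ) + Q * θ k)) / Q + z := by
      rw [Int.fract, ← ht]
      field_simp
      linarith
    rw [harg, Int.fract_add_intCast, hc]
    refine le_trans (by simpa using key) (le_of_eq ?_)
    simp only [hF]
    congr 2
    · simp
    · have : (c = Q - 1) ↔ ((c : ℤ) = Q - 1) := by omega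
      simp [this]
  have hsumF : ∑ k ∈ Finset.range Q, F ((P * k + t) % Q) ≤ 4 := by
    rw [sum_range_emod_affine hQ h]
    simp only [hF, Finset.sum_add_distrib, Finset.sum_const, Finset.card_range, nsmul_eq_mul]
    have e1 : ∑ x ∈ Finset.range Q, (if (x : ℤ) = 0 then (1 : ℝ) else 0) ≤ 1 := by
      simp only [Nat.cast_eq_zero]
      rw [Finset.sum_ite_eq']; split_ifs <;> norm_num
    have e2 : ∑ x ∈ Finset.range Q, (if (x : ℤ) = Q - 1 then (1 : ℝ) else 0) ≤ 1 := by
      have : ∀ x : ℕ, ((x : ℤ) = Q - 1) ↔ x = Q - 1 := by intro x; omega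
      simp only [this]
      rw [Finset.sum_ite_eq']; split_ifs <;> norm_num
    have e3 : (Q : ℝ) * (2 / Q) = 2 := by field_simp
    linarith
  have hsumc : ∑ k ∈ Finset.range Q, (((P * k + t) % Q : ℤ) : ℝ) / Q = ((Q : ℝ) - 1) / 2 := by
    rw [sum_range_emod_affine hQ h t (fun c => (c : ℝ) / Q), ← Finset.sum_div]
    have := Finset.sum_range_id_mul_two Q
    have h2 : (∑ i ∈ Finset.range Q, (i : ℝ)) * 2 = Q * (Q - 1) := by
      have h3 : (((∑ i ∈ Finset.range Q, i) * 2 : ℕ) : ℝ) = ((Q * (Q - 1) : ℕ) : ℝ) := by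
        rw [this]
      push_cast [Nat.cast_sub hQ] at h3
      exact h3
    simp only [Int.cast_natCast]
    field_simp
    linarith
  have hdecomp : ∑ k ∈ Finset.range Q, (Int.fract ((P * k : ℝ) / Q + γ + θ k) - 1 / 2) =
      ∑ k ∈ Finset.range Q,
        (Int.fract ((P * k : ℝ) / Q + γ + θ k) - (((P * k + t) % Q : ℤ) : ℝ) / Q) - 1 / 2 := by
    simp only [Finset.sum_sub_distrib, hsumc, Finset.sum_const, Finset.card_range, nsmul_eq_mul]
    ring
  have hb := (Finset.abs_sum_le_sum_abs _ _).trans ((Finset.sum_le_sum hterm).trans hsumF)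
  rw [hdecomp]
  rw [abs_le] at hb ⊢
  constructor <;> linarith

lemma abs_sum_range_le_block {u : ℤ → ℝ} {B : ℝ} {Q : ℕ}
    (hB : ∀ a : ℤ, |∑ k ∈ Finset.range Q, u (a + k)| ≤ B) (a : ℤ) (s N : ℕ) :
    |∑ k ∈ Finset.range (Q * s + N), u (a + k)| ≤
      B * s + |∑ k ∈ Finset.range N, u (a + (Q * s : ℕ) + k)| := by
  induction s generalizing a with
  | zero => simp
  | succ s ih =>
    have e : Q * (s + 1) + N = Q + (Q * s + N) := by ring
    rw [e, Finset.sum_range_add]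
    have h1 := ih (a + Q)
    have h2 := hB a
    have e1 : ∀ k : ℕ, a + ((Q + k : ℕ) : ℤ) = a + Q + k := by intro k; push_cast; ring
    have e2 : ∀ k : ℕ, a + ((Q * (s + 1) : ℕ) : ℤ) + k = a + Q + (Q * s : ℕ) + k := by
      intro k; push_cast; ring
    simp only [e1, e2]
    refine (abs_add_le _ _).trans ?_
    push_cast at h1 ⊢
    linarith

lemma abs_sum_range_le_levels {u : ℤ → ℝ} {B : ℝ} {n : ℕ} {Q : ℕ → ℕ} (h0 : Q 0 = 1)
    (hpos : ∀ l < n, 0 < Q l) (hB0 : 0 ≤ B)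
    (hB : ∀ l < n, ∀ a : ℤ, |∑ k ∈ Finset.range (Q l), u (a + k)| ≤ B) :
    ∀ m ≤ n, ∀ N < Q m, ∀ a : ℤ, |∑ k ∈ Finset.range N, u (a + k)| ≤
      B * ∑ l ∈ Finset.range m, ((min N (Q (l + 1)) / Q l : ℕ) : ℝ) := by
  intro m
  induction m with
  | zero =>
    intro _ N hN a
    rw [h0, Nat.lt_one_iff] at hN
    simp [hN]
  | succ m ih =>
    intro hm N hN a
    have hm' : m < n := hm
    have hmod := Nat.mod_lt N (hpos m hm')
    have h1 := abs_sum_range_le_block (hB m hm') a (N / Q m) (N % Q m)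
    rw [Nat.div_add_mod] at h1
    refine h1.trans ?_
    rw [Finset.sum_range_succ, min_eq_left hN.le, mul_add, add_comm]
    gcongr
    refine (ih hm'.le _ hmod _).trans ?_
    gcongr
    exact Nat.mod_le _ _

lemma sum_min_div_le {Q R : ℕ} (hQ : 0 < Q) (hQR : Q ≤ R) (M : ℕ) :
    ∑ j ∈ Finset.range M, ((min (j + 1) R / Q : ℕ) : ℝ) / ((j + 1) * (j + 2)) ≤
      1 / Q * (Real.log (R / Q) + 1) := by
  have hQ' : (0 : ℝ) < Q := by exact_mod_cast hQ
  have hR' : (0 : ℝ) < R := by exact_mod_cast hQ.trans_le hQR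
  set ψ : ℕ → ℝ := fun j => 1 / Q * (Real.log ((max (min (j + 1) R) Q : ℕ) : ℝ) -
    R / ((max (j + 1) R : ℕ) : ℝ)) with hψ
  have hterm : ∀ j ∈ Finset.range M,
      ((min (j + 1) R / Q : ℕ) : ℝ) / ((j + 1) * (j + 2)) ≤ ψ (j + 1) - ψ j := by
    intro j _
    have hj0 : (0 : ℝ) ≤ j := Nat.cast_nonneg j
    rcases lt_or_ge (j + 1) Q with h1 | h1
    · have a1 : min (j + 1) R / Q = 0 := Nat.div_eq_of_lt (by omega)
      have a2 : max (min (j + 1) R) Q = Q := by omega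
      have a3 : max (min (j + 1 + 1) R) Q = Q := by omega
      have a4 : max (j + 1) R = R := by omega
      have a5 : max (j + 1 + 1) R = R := by omega
      simp only [hψ, a1, a2, a3, a4, a5]
      simp
    rcases lt_or_ge (j + 1) R with h2 | h2
    · have a1 : min (j + 1) R = j + 1 := by omega
      have a2 : max (j + 1) Q = j + 1 := by omega
      have a3 : max (min (j + 1 + 1) R) Q = j + 2 := by omega
      have a4 : max (j + 1) R = R := by omega
      have a5 : max (j + 1 + 1) R = R := by omega
      simp only [hψ, a1, a2, a3, a4, a5]
      have hdiv : (((j + 1) / Q : ℕ) : ℝ) ≤ (j + 1) / Q := by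
        have := @Nat.cast_div_le ℝ _ _ _ (j + 1) Q
        push_cast at this; exact this
      have hlog : 1 / ((j : ℝ) + 2) ≤ Real.log ((j : ℝ) + 2) - Real.log (j + 1) := by
        rw [← Real.log_div (by positivity) (by positivity)]
        have := Real.one_sub_inv_le_log_of_pos (x := ((j : ℝ) + 2) / (j + 1)) (by positivity)
        refine le_trans (le_of_eq ?_) this
        field_simp
        ring
      calc _ ≤ ((j : ℝ) + 1) / Q / ((j + 1) * (j + 2)) := by gcongr
        _ = 1 / Q * (1 / ((j : ℝ) + 2)) := by field_simp
        _ ≤ 1 / Q * (Real.log ((j : ℝ) + 2) - Real.log (j + 1)) := by gcongr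
        _ = _ := by push_cast; ring
    · have a1 : min (j + 1) R = R := by omega
      have a2 : max R Q = R := by omega
      have a3 : min (j + 1 + 1) R = R := by omega
      have a4 : max (j + 1) R = j + 1 := by omega
      have a5 : max (j + 1 + 1) R = j + 2 := by omega
      simp only [hψ, a1, a2, a3, a4, a5]
      have hdiv : ((R / Q : ℕ) : ℝ) ≤ R / Q := Nat.cast_div_le
      calc _ ≤ (R : ℝ) / Q / ((j + 1) * (j + 2)) := by gcongr
        _ = _ := by push_cast; field_simp; ring
  refine (Finset.sum_le_sum hterm).trans ?_
  rw [Finset.sum_range_sub]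
  simp only [hψ]
  rw [← mul_sub]
  gcongr
  rw [Real.log_div hR'.ne' hQ'.ne']
  have b1 : Real.log ((max (min (M + 1) R) Q : ℕ) : ℝ) ≤ Real.log R := by
    apply Real.log_le_log
    · exact_mod_cast (by omega : 0 < max (min (M + 1) R) Q)
    · exact_mod_cast (by omega : max (min (M + 1) R) Q ≤ R)
  have b2 : Real.log Q ≤ Real.log ((max (min (0 + 1) R) Q : ℕ) : ℝ) := by
    apply Real.log_le_log hQ'
    exact_mod_cast (by omega : Q ≤ max (min (0 + 1) R) Q)
  have b3 : 0 ≤ (R : ℝ) / ((max (M + 1) R : ℕ) : ℝ) := by positivity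
  have b4 : (R : ℝ) / ((max (0 + 1) R : ℕ) : ℝ) ≤ 1 := by
    have : max (0 + 1) R = R := by omega
    rw [this, div_self hR'.ne']
  linarith

lemma sum_div_eq_abel (v : ℕ → ℝ) (M : ℕ) :
    ∑ j ∈ Finset.range M, v j / (j + 1) =
      (∑ j ∈ Finset.range M, v j) / (M + 1) +
        ∑ j ∈ Finset.range M, (∑ i ∈ Finset.range (j + 1), v i) / ((j + 1) * (j + 2)) := by
  induction M with
  | zero => simp
  | succ M ih =>
    rw [Finset.sum_range_succ, ih, Finset.sum_range_succ (fun j => _ / _),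
      Finset.sum_range_succ v]
    push_cast
    field_simp
    ring

lemma exists_bound_weighted_sawtooth {c : ℝ} (hc : 0 < c) :
    ∃ C : ℝ, 0 ≤ C ∧ ∀ (n q : ℕ) (r : ℤ) (Q : ℕ → ℕ) (P : ℕ → ℤ), Q 0 = 1 → Q n = q → 0 < q →
      (∀ l < n, (2 / 3 : ℝ) * (3 / 2) ^ l ≤ Q l) → (∀ l < n, Q l ≤ Q (l + 1)) →
      (∀ l < n, (Q (l + 1) : ℝ) ≤ 2 * Real.exp (c * (l + 1)) * Q l) →
      (∀ l < n, IsCoprime (P l) (Q l)) →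
      (∀ l < n, |Q l * r - P l * q| * Q l ≤ q) →
      ∀ s : ℤ, |∑ j ∈ Finset.range (q - 1),
        (Int.fract (((r * (1 + j : ℤ) + s : ℤ) : ℝ) / q) - 1 / 2) / ((j : ℝ) + 1)| ≤ C := by
  set G : ℕ → ℝ := fun l => 3 / 2 * (2 / 3 : ℝ) ^ l * (2 + c * (l + 1)) with hG
  have hGnn : ∀ l, 0 ≤ G l := fun l => by simp only [hG]; positivity
  have hGs : Summable G := by
    have h1 : Summable fun l : ℕ => (2 / 3 : ℝ) ^ l :=
      summable_geometric_of_lt_one (by norm_num) (by norm_num)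
    have h2 : Summable fun l : ℕ => (l : ℝ) ^ 1 * (2 / 3 : ℝ) ^ l :=
      summable_pow_mul_geometric_of_norm_lt_one 1 (by norm_num [abs_of_pos])
    refine ((h1.mul_left (3 / 2 * (2 + c))).add (h2.mul_left (3 / 2 * c))).congr fun l => ?_
    simp only [hG]
    ring
  refine ⟨1 + 5 * ∑' l, G l, add_nonneg zero_le_one (mul_nonneg (by norm_num) (tsum_nonneg hGnn)), ?_⟩
  intro n q r Q P h0 hn hq hgrow hmono hratio hcop happ s
  have hqR : (0 : ℝ) < q := by exact_mod_cast hq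
  have hpos : ∀ l < n, 0 < Q l := fun l hl => by
    have := (show (0 : ℝ) < 2 / 3 * (3 / 2) ^ l by positivity).trans_le (hgrow l hl)
    exact_mod_cast this
  set u : ℤ → ℝ := fun j => Int.fract (((r * j + s : ℤ) : ℝ) / q) - 1 / 2 with hu
  have hu1 : ∀ j, |u j| ≤ 1 / 2 := fun j => by
    have h1 := Int.fract_nonneg (((r * j + s : ℤ) : ℝ) / q)
    have h2 := Int.fract_lt_one (((r * j + s : ℤ) : ℝ) / q)
    rw [abs_le]; constructor <;> simp only [hu] <;> linarith
  have hblock : ∀ l < n, ∀ a : ℤ, |∑ k ∈ Finset.range (Q l), u (a + k)| ≤ 5 := by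
    intro l hl a
    have hQl : (0 : ℝ) < Q l := by exact_mod_cast hpos l hl
    set d : ℤ := Q l * r - P l * q with hd
    have happ' : |(d : ℝ)| * Q l ≤ q := by exact_mod_cast happ l hl
    have := abs_sum_fract_sub_half_le (hpos l hl) (hcop l hl) ((r * a + s) / q)
      (fun k => k * d / (Q l * q)) (by
        intro k hk
        have hk' : (k : ℝ) ≤ Q l := by exact_mod_cast hk.le
        rw [abs_div, abs_mul, abs_of_pos (mul_pos hQl hqR), Nat.abs_cast,
          div_le_div_iff₀ (mul_pos hQl hqR) hQl]
        calc (k : ℝ) * |(d : ℝ)| * Q l = k * (|(d : ℝ)| * Q l) := by ring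
          _ ≤ Q l * q := by gcongr
          _ = _ := by ring)
    refine le_trans (le_of_eq ?_) this
    congr 1
    refine Finset.sum_congr rfl fun k _ => ?_
    simp only [hu]
    congr 2
    simp only [hd]
    push_cast
    field_simp
    ring
  have hlev := abs_sum_range_le_levels h0 hpos (by norm_num) hblock n le_rfl
  rw [hn] at hlev
  have hsum := sum_div_eq_abel (fun j => u (1 + j)) (q - 1)
  simp only [hu] at hsum
  rw [hsum]
  refine (abs_add_le _ _).trans (add_le_add ?_ ?_)
  · rw [abs_div, abs_of_pos (by positivity : (0 : ℝ) < ((q - 1 : ℕ) : ℝ) + 1), div_le_one (by positivity)]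
    refine (Finset.abs_sum_le_sum_abs _ _).trans ?_
    refine (Finset.sum_le_card_nsmul _ _ (1 / 2) fun (j : ℕ) _ => hu1 (1 + j)).trans ?_
    simp only [Finset.card_range, nsmul_eq_mul]
    have : (0 : ℝ) ≤ ((q - 1 : ℕ) : ℝ) := Nat.cast_nonneg _
    linarith
  · have hstep : ∀ j ∈ Finset.range (q - 1),
        |(∑ i ∈ Finset.range (j + 1), u (1 + i)) / (((j : ℝ) + 1) * (j + 2))| ≤
          ∑ l ∈ Finset.range n,
            5 * (((min (j + 1) (Q (l + 1)) / Q l : ℕ) : ℝ) / ((j + 1) * (j + 2))) := by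
      intro j hj
      rw [abs_div, abs_of_pos (by positivity : (0 : ℝ) < ((j : ℝ) + 1) * (j + 2)),
        ← Finset.mul_sum, ← Finset.sum_div, ← mul_div_assoc]
      gcongr
      exact hlev (j + 1) (by have := Finset.mem_range.1 hj; omega) 1
    refine (Finset.abs_sum_le_sum_abs _ _).trans ((Finset.sum_le_sum hstep).trans ?_)
    rw [Finset.sum_comm, ← tsum_mul_left]
    refine le_trans (Finset.sum_le_sum fun l hl => ?_)
      ((hGs.mul_left 5).sum_le_tsum (Finset.range n) fun l _ => mul_nonneg (by norm_num) (hGnn l))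
    rw [← Finset.mul_sum]
    have hl' := Finset.mem_range.1 hl
    have hQl : (0 : ℝ) < Q l := by exact_mod_cast hpos l hl'
    have hQl1 : (0 : ℝ) < Q (l + 1) := by exact_mod_cast (hpos l hl').trans_le (hmono l hl')
    refine mul_le_mul_of_nonneg_left ?_ (by norm_num)
    refine (sum_min_div_le (hpos l hl') (hmono l hl') (q - 1)).trans ?_
    have hinv : 1 / (Q l : ℝ) ≤ 3 / 2 * (2 / 3) ^ l := by
      rw [div_le_iff₀ hQl]
      calc (1 : ℝ) = 3 / 2 * (2 / 3) ^ l * (2 / 3 * (3 / 2) ^ l) := by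
            have : (2 / 3 : ℝ) ^ l * (3 / 2) ^ l = 1 := by rw [← mul_pow]; norm_num
            linear_combination -this
        _ ≤ _ := by gcongr; exact hgrow l hl'
    have hlog : Real.log ((Q (l + 1) : ℝ) / Q l) + 1 ≤ 2 + c * (l + 1) := by
      have h1 : (Q (l + 1) : ℝ) / Q l ≤ 2 * Real.exp (c * (l + 1)) := by
        rw [div_le_iff₀ hQl]; exact hratio l hl'
      have h2 := Real.log_le_log (by positivity) h1
      rw [Real.log_mul (by norm_num) (Real.exp_pos _).ne', Real.log_exp] at h2
      have := Real.log_two_lt_d9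
      linarith
    have hlog0 : 0 ≤ Real.log ((Q (l + 1) : ℝ) / Q l) := by
      apply Real.log_nonneg
      rw [one_le_div hQl]
      exact_mod_cast hmono l hl'
    simp only [hG]
    gcongr

/-- Denominators of the continued fraction `[0; a_n, a_{n-1}, …]`. -/
def revDen (a : ℕ → ℕ) (n : ℕ) : ℕ → ℕ
  | 0 => 1
  | 1 => a n
  | m + 2 => a (n - (m + 1)) * revDen a n (m + 1) + revDen a n m

/-- Numerators of the continued fraction `[0; a_n, a_{n-1}, …]`. -/
def revNum (a : ℕ → ℕ) (n : ℕ) : ℕ → ℤ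
  | 0 => 0
  | 1 => 1
  | m + 2 => a (n - (m + 1)) * revNum a n (m + 1) + revNum a n m

lemma revNum_mul_revDen_sub (a : ℕ → ℕ) (n m : ℕ) :
    revNum a n (m + 1) * revDen a n m - revNum a n m * revDen a n (m + 1) = (-1) ^ m := by
  induction m with
  | zero => simp [revNum, revDen]
  | succ m ih =>
    rw [revNum, revDen, pow_succ, ← ih]
    push_cast
    ring

lemma isCoprime_revNum_revDen (a : ℕ → ℕ) (n m : ℕ) :
    IsCoprime (revNum a n m) (revDen a n m) := by
  have h := revNum_mul_revDen_sub a n m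
  have h1 : ((-1 : ℤ) ^ m) * (-1) ^ m = 1 := by rw [← mul_pow]; norm_num
  exact ⟨-(-1) ^ m * revDen a n (m + 1), (-1) ^ m * revNum a n (m + 1), by
    linear_combination (-1) ^ m * h + h1⟩

lemma le_revDen {a : ℕ → ℕ} (ha : ∀ n, 1 ≤ n → 1 ≤ a n) {n : ℕ} :
    ∀ m ≤ n, (2 / 3 : ℝ) * (3 / 2) ^ m ≤ revDen a n m
  | 0, _ => by norm_num [revDen]
  | 1, h => by
    have : (1 : ℝ) ≤ a n := by exact_mod_cast ha n h
    norm_num [revDen, this]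
  | m + 2, h => by
    have h1 := le_revDen ha (n := n) (m + 1) (by omega)
    have h2 := le_revDen ha (n := n) m (by omega)
    have h3 : (1 : ℝ) ≤ a (n - (m + 1)) := by exact_mod_cast ha _ (by omega)
    have h4 : (0 : ℝ) ≤ revDen a n (m + 1) := by positivity
    rw [revDen]
    push_cast
    have h5 : (0 : ℝ) < (3 / 2) ^ m := by positivity
    rw [pow_succ] at h1
    rw [pow_succ, pow_succ]
    nlinarith

lemma revDen_le_succ {a : ℕ → ℕ} (ha : ∀ n, 1 ≤ n → 1 ≤ a n) {n m : ℕ} (h : m < n) :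
    revDen a n m ≤ revDen a n (m + 1) := by
  cases m with
  | zero => simpa [revDen] using ha n h
  | succ m =>
    rw [revDen]
    have := ha (n - (m + 1)) (by omega)
    nlinarith

lemma revDen_succ_le {a : ℕ → ℕ} (ha : ∀ n, 1 ≤ n → 1 ≤ a n) {n m : ℕ} (h : m < n) :
    revDen a n (m + 1) ≤ (a (n - m) + 1) * revDen a n m := by
  cases m with
  | zero => simp [revDen]
  | succ m =>
    rw [revDen, add_mul, one_mul]
    gcongr
    exact revDen_le_succ ha (by omega)

/-- The denominators of the convergents with partial quotients `a`. -/
structure IsDenSeq (a q : ℕ → ℕ) : Prop where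
  zero : q 0 = 1
  one : q 1 = a 1
  step : ∀ n, q (n + 2) = a (n + 2) * q (n + 1) + q n

lemma IsDenSeq.revDen_mul_sub_aux {a q : ℕ → ℕ} (h : IsDenSeq a q) (m : ℕ) :
    ∀ e n, n = m + e + 2 →
      ((revDen a n m : ℤ) * q (n - 1) - revNum a n m * q n = (-1) ^ m * q (e + 1)) ∧
      ((revDen a n (m + 1) : ℤ) * q (n - 1) - revNum a n (m + 1) * q n = (-1) ^ (m + 1) * q e) ∧
      revDen a n (m + 1) * q (e + 1) + revDen a n m * q e = q n := by
  induction m with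
  | zero =>
    rintro e n rfl
    have := h.step e
    refine ⟨?_, ?_, ?_⟩
    · simp [revDen, revNum]
    · rw [show 0 + e + 2 - 1 = e + 1 by omega, show 0 + e + 2 = e + 2 by omega, this]
      simp [revDen, revNum]
    · rw [show 0 + e + 2 = e + 2 by omega, this]
      simp [revDen]
  | succ m ih =>
    intro e n hn
    obtain ⟨h1, h2, h3⟩ := ih (e + 1) n (by omega)
    have hs := h.step e
    have hi : n - (m + 1) = e + 2 := by omega
    have hs' : (q (e + 2) : ℤ) = a (e + 2) * q (e + 1) + q e := by exact_mod_cast hs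
    have h1' : (revDen a n m : ℤ) * q (n - 1) - revNum a n m * q n = (-1) ^ m * q (e + 2) := h1
    refine ⟨h2, ?_, ?_⟩
    · rw [revDen, revNum, hi]
      push_cast
      rw [pow_succ, pow_succ]
      rw [pow_succ] at h2
      linear_combination h1' + (a (e + 2) : ℤ) * h2 + (-1) ^ m * hs'
    · rw [revDen, hi, ← h3]
      have : q (e + 1 + 1) = a (e + 2) * q (e + 1) + q e := hs
      rw [this]
      ring

lemma IsDenSeq.revDen_self {a q : ℕ → ℕ} (h : IsDenSeq a q) :
    ∀ n, revDen a n n = q n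
  | 0 => by simp [revDen, h.zero]
  | 1 => by simp [revDen, h.one]
  | n + 2 => by
    have := (h.revDen_mul_sub_aux n 0 (n + 2) rfl).2.2
    rw [h.zero, zero_add, h.one] at this
    rw [← this, revDen, show n + 2 - (n + 1) = 1 by omega]
    ring

lemma IsDenSeq.abs_revDen_mul_sub_le {a q : ℕ → ℕ} (h : IsDenSeq a q)
    (ha : ∀ n, 1 ≤ n → 1 ≤ a n) {n m : ℕ} (hm : m < n) :
    |(revDen a n m : ℤ) * q (n - 1) - revNum a n m * q n| * revDen a n m ≤ q n := by
  have hmono := revDen_le_succ ha hm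
  rcases Nat.lt_or_ge (m + 1) n with h1 | h1
  · obtain ⟨e, rfl⟩ : ∃ e, n = m + e + 2 := ⟨n - m - 2, by omega⟩
    obtain ⟨g1, g2, g3⟩ := h.revDen_mul_sub_aux m e _ rfl
    rw [g1, abs_mul, abs_pow, abs_neg, abs_one, one_pow, one_mul, Nat.abs_cast, ← g3]
    norm_cast
    nlinarith
  · obtain rfl : n = m + 1 := by omega
    have key : |(revDen a (m + 1) m : ℤ) * q (m + 1 - 1) - revNum a (m + 1) m * q (m + 1)| = 1 := by
      cases m with
      | zero => simp [revDen, revNum, h.zero]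
      | succ m =>
        rw [(h.revDen_mul_sub_aux m 0 _ rfl).2.1, h.zero, abs_mul, abs_pow]
        simp
    rw [key, one_mul, ← h.revDen_self]
    exact_mod_cast hmono

lemma IsDenSeq.exists_bound_sawtooth {a q : ℕ → ℕ} (h : IsDenSeq a q)
    (ha : ∀ n, 1 ≤ n → 1 ≤ a n) {c : ℝ} (hc : 0 < c) :
    ∃ C : ℝ, 0 ≤ C ∧ ∀ n : ℕ, 0 < q n →
      (∀ l, 1 ≤ l → l ≤ n → (a (n + 1 - l) : ℝ) ≤ Real.exp (c * l)) →
      ∀ r : ℤ, r = q (n - 1) ∨ r = -q (n - 1) →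
      ∀ s : ℤ, |∑ j ∈ Finset.range (q n - 1),
        (Int.fract (((r * (1 + j : ℤ) + s : ℤ) : ℝ) / q n) - 1 / 2) / ((j : ℝ) + 1)| ≤ C := by
  obtain ⟨C, hC0, hC⟩ := exists_bound_weighted_sawtooth hc
  refine ⟨C, hC0, fun n hn hexp => ?_⟩
  have hratio : ∀ l < n,
      (revDen a n (l + 1) : ℝ) ≤ 2 * Real.exp (c * (l + 1)) * revDen a n l := by
    intro l hl
    have h1 : (revDen a n (l + 1) : ℝ) ≤ (a (n - l) + 1) * revDen a n l := by
      exact_mod_cast revDen_succ_le ha hl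
    have h2 := hexp (l + 1) (by omega) hl
    rw [show n + 1 - (l + 1) = n - l by omega] at h2
    push_cast at h2
    have h3 : (1 : ℝ) ≤ a (n - l) := by exact_mod_cast ha _ (by omega)
    refine h1.trans ?_
    gcongr
    linarith
  have main := fun r P => hC n (q n) r (revDen a n) P rfl (h.revDen_self n) hn
    (fun l hl => le_revDen ha l hl.le) (fun l hl => revDen_le_succ ha hl) hratio
  rintro r (rfl | rfl)
  · exact main _ (revNum a n) (fun l _ => isCoprime_revNum_revDen a n l)
      (fun l hl => h.abs_revDen_mul_sub_le ha hl)
  · refine main _ (fun l => -revNum a n l) (fun l _ => (isCoprime_revNum_revDen a n l).neg_left)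
      (fun l hl => ?_)
    rw [show (revDen a n l : ℤ) * -q (n - 1) - -revNum a n l * q n =
      -(revDen a n l * q (n - 1) - revNum a n l * q n) by ring, abs_neg]
    exact h.abs_revDen_mul_sub_le ha hl

lemma symLog_of_mem {t : ℝ} (h0 : 0 ≤ t) (h1 : t < 1) :
    symLog t = -Real.log t - Real.log (1 - t) := by
  rw [symLog, Int.fract_eq_self.2 ⟨h0, h1⟩]

lemma symLog_add_intCast (t : ℝ) (z : ℤ) : symLog (t + z) = symLog t := by
  simp [symLog]

lemma abs_symLog_add_log_le {η : ℝ} (h : |η| ≤ 3 / 5) : |symLog η + Real.log (|η|)| ≤ 2 := by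
  have h1 : symLog η + Real.log |η| = -Real.log (1 - |η|) := by
    rcases le_or_gt 0 η with h0 | h0
    · rw [abs_of_nonneg h0] at h ⊢
      rw [symLog_of_mem h0 (by linarith)]
      ring
    · rw [abs_of_neg h0] at h ⊢
      have : symLog η = symLog (1 + η) := by
        rw [← symLog_add_intCast η 1, Int.cast_one, add_comm]
      rw [this, symLog_of_mem (by linarith) (by linarith), sub_add_cancel_left, sub_neg_eq_add]
      ring
  rw [h1, abs_neg]
  have h2 := abs_nonneg η
  have h3 := Real.log_le_sub_one_of_pos (x := 1 - |η|) (by linarith)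
  have h4 := Real.one_sub_inv_le_log_of_pos (x := 1 - |η|) (by linarith)
  have h5 : (1 - |η|)⁻¹ ≤ 5 / 2 := by
    rw [inv_le_comm₀ (by linarith) (by norm_num)]; linarith
  rw [abs_le]; constructor <;> linarith

lemma abs_log_add_sub_le {c w : ℝ} (hc : 1 ≤ c) (hw : |w| ≤ 3 / 5) :
    |Real.log (c + w) - Real.log c - w / c| ≤ 1 / c ^ 2 := by
  have hc0 : 0 < c := by linarith
  have hw' := abs_le.1 hw
  have h1 : Real.log (c + w) - Real.log c = Real.log (1 + w / c) := by
    rw [← Real.log_div (by linarith) hc0.ne']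
    congr 1
    field_simp
  have hpos : 0 < 1 + w / c := by
    rw [show 1 + w / c = (c + w) / c by field_simp]
    apply div_pos <;> linarith
  have h3 := Real.log_le_sub_one_of_pos hpos
  have h4 := Real.one_sub_inv_le_log_of_pos hpos
  have h5 : 1 - (1 + w / c)⁻¹ - w / c = -(w ^ 2 / (c * (c + w))) := by
    have : c + w ≠ 0 := by linarith
    rw [show 1 + w / c = (c + w) / c by field_simp]
    field_simp
    ring
  have h6 : w ^ 2 / (c * (c + w)) ≤ 1 / c ^ 2 := by
    rw [div_le_div_iff₀ (by nlinarith) (by positivity)]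
    have : w ^ 2 ≤ 9 / 25 := by nlinarith [abs_nonneg w, sq_abs w]
    nlinarith
  have h7 : 0 ≤ 1 / c ^ 2 := by positivity
  rw [h1, abs_le]
  constructor <;> linarith

lemma abs_symLog_div_add_sub_le {c d q η : ℝ} (hc : 1 ≤ c) (hd : 1 ≤ d) (hq : c + d = q)
    (hη : |q * η| ≤ 3 / 5) :
    |symLog (c / q + η) - symLog (c / q) + q * η * (1 / c - 1 / d)| ≤ 1 / c ^ 2 + 1 / d ^ 2 := by
  have hq0 : 0 < q := by linarith
  have hw := abs_le.1 hη
  have key : ∀ w, |w| ≤ 3 / 5 →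
      symLog ((c + w) / q) = -Real.log (c + w) - Real.log (d + -w) + 2 * Real.log q := by
    intro w hw
    have hw := abs_le.1 hw
    rw [symLog_of_mem (div_nonneg (by linarith) hq0.le) (by rw [div_lt_one hq0]; linarith),
      show 1 - (c + w) / q = (d + -w) / q by field_simp; linarith,
      Real.log_div (by linarith) hq0.ne', Real.log_div (by linarith) hq0.ne']
    ring
  have k1 := key (q * η) hη
  have k0 := key 0 (by norm_num)
  have e1 : c / q + η = (c + q * η) / q := by field_simp
  rw [add_zero, neg_zero, add_zero] at k0
  rw [e1, k1, k0]
  have b1 := abs_le.1 (abs_log_add_sub_le hc hη)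
  have b2 := abs_le.1 (abs_log_add_sub_le hd (w := -(q * η)) (by rwa [abs_neg]))
  have e2 : q * η * (1 / c - 1 / d) = q * η / c + -(q * η) / d := by ring
  rw [e2, abs_le]
  constructor <;> linarith

lemma sum_inv_sq_le (m : ℕ) : ∑ j ∈ Finset.range m, 1 / ((j : ℝ) + 1) ^ 2 ≤ 2 := by
  have h : ∀ j ∈ Finset.range m, 1 / ((j : ℝ) + 1) ^ 2 ≤
      -(2 / (((j + 1 : ℕ) : ℝ) + 1)) - -(2 / ((j : ℝ) + 1)) := by
    intro j _
    have : (0 : ℝ) ≤ j := Nat.cast_nonneg j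
    rw [show -(2 / (((j + 1 : ℕ) : ℝ) + 1)) - -(2 / ((j : ℝ) + 1)) =
      2 / (((j : ℝ) + 1) * (j + 2)) by push_cast; field_simp; ring]
    rw [div_le_div_iff₀ (by positivity) (by positivity)]
    nlinarith
  refine (Finset.sum_le_sum h).trans ?_
  rw [Finset.sum_range_sub (fun j : ℕ => -(2 / ((j : ℝ) + 1)))]
  have : (0 : ℝ) ≤ 2 / ((m : ℝ) + 1) := by positivity
  simp only [Nat.cast_zero]
  linarith

lemma abs_sum_symLog_perturbed_grid_sub_le {C κ y : ℝ} {m : ℕ} {η : ℕ → ℝ} {U : ℤ → ℝ}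
    (hU : ∀ c : ℤ, U (c + (m + 1 : ℕ)) = U c)
    (h1 : |∑ j ∈ Finset.range m, (U (1 + j) - 1 / 2) / ((j : ℝ) + 1)| ≤ C)
    (h2 : |∑ j ∈ Finset.range m, (U (-(1 + j)) - 1 / 2) / ((j : ℝ) + 1)| ≤ C)
    (hκ : |κ| ≤ 1)
    (hη : ∀ j < m, ((m : ℝ) + 1) * η (j + 1) = y + κ * U (1 + j))
    (hη' : ∀ j < m, |((m : ℝ) + 1) * η (j + 1)| ≤ 3 / 5) :
    |∑ j ∈ Finset.range m, (symLog (((j : ℝ) + 1) / (m + 1) + η (j + 1)) -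
      symLog (((j : ℝ) + 1) / (m + 1)))| ≤ 4 + 2 * C := by
  have hrefl : ∀ F : ℕ → ℝ, ∑ j ∈ Finset.range m, F (m - 1 - j) = ∑ j ∈ Finset.range m, F j :=
    fun F => Finset.sum_range_reflect F m
  have hcast : ∀ j ∈ Finset.range m, ((m - 1 - j : ℕ) : ℝ) = m - (j + 1) := by
    intro j hj
    have := Finset.mem_range.1 hj
    have h : m - 1 - j + 1 + j = m := by omega
    have h' : ((m - 1 - j : ℕ) : ℝ) + 1 + j = m := by exact_mod_cast h
    linarith
  have hsym : ∑ j ∈ Finset.range m, 1 / ((m : ℝ) - j) = ∑ j ∈ Finset.range m, 1 / ((j : ℝ) + 1) := by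
    rw [← hrefl]
    exact Finset.sum_congr rfl fun j hj => by rw [hcast j hj, sub_sub_cancel]
  have hsq : ∑ j ∈ Finset.range m, 1 / ((m : ℝ) - j) ^ 2 ≤ 2 := by
    refine le_trans (le_of_eq ?_) (sum_inv_sq_le m)
    rw [← hrefl]
    exact Finset.sum_congr rfl fun j hj => by rw [hcast j hj, sub_sub_cancel]
  have hUr : ∑ j ∈ Finset.range m, (U (1 + j) - 1 / 2) / ((m : ℝ) - j) =
      ∑ j ∈ Finset.range m, (U (-(1 + j)) - 1 / 2) / ((j : ℝ) + 1) := by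
    rw [← hrefl]
    refine Finset.sum_congr rfl fun j hj => ?_
    have hj' := Finset.mem_range.1 hj
    rw [hcast j hj, sub_sub_cancel, ← hU (-(1 + (j : ℤ)))]
    congr 3
    omega
  have hlin : ∑ j ∈ Finset.range m,
      ((m : ℝ) + 1) * η (j + 1) * (1 / ((j : ℝ) + 1) - 1 / ((m : ℝ) - j)) =
      κ * (∑ j ∈ Finset.range m, (U (1 + j) - 1 / 2) / ((j : ℝ) + 1) -
        ∑ j ∈ Finset.range m, (U (-(1 + j)) - 1 / 2) / ((j : ℝ) + 1)) := by
    rw [← hUr]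
    have : ∑ j ∈ Finset.range m,
        ((m : ℝ) + 1) * η (j + 1) * (1 / ((j : ℝ) + 1) - 1 / ((m : ℝ) - j)) =
        ∑ j ∈ Finset.range m, (κ * ((U (1 + j) - 1 / 2) / ((j : ℝ) + 1)) -
          κ * ((U (1 + j) - 1 / 2) / ((m : ℝ) - j)) +
          ((y + κ / 2) * (1 / ((j : ℝ) + 1)) - (y + κ / 2) * (1 / ((m : ℝ) - j)))) := by
      refine Finset.sum_congr rfl fun j hj => ?_
      rw [hη j (Finset.mem_range.1 hj)]
      ring
    rw [this]
    simp only [Finset.sum_add_distrib, Finset.sum_sub_distrib, ← Finset.mul_sum, hsym]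
    ring
  have hterm : ∀ j ∈ Finset.range m,
      |symLog (((j : ℝ) + 1) / (m + 1) + η (j + 1)) - symLog (((j : ℝ) + 1) / (m + 1)) +
        ((m : ℝ) + 1) * η (j + 1) * (1 / ((j : ℝ) + 1) - 1 / ((m : ℝ) - j))| ≤
      1 / ((j : ℝ) + 1) ^ 2 + 1 / ((m : ℝ) - j) ^ 2 := by
    intro j hj
    have hj' := Finset.mem_range.1 hj
    have hjm : (j : ℝ) + 1 ≤ m := by exact_mod_cast hj'
    have hj0 : (0 : ℝ) ≤ j := Nat.cast_nonneg j
    exact abs_symLog_div_add_sub_le (by linarith) (by linarith) (by ring) (hη' j hj')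
  have hsum := (Finset.abs_sum_le_sum_abs _ _).trans (Finset.sum_le_sum hterm)
  rw [Finset.sum_add_distrib, Finset.sum_add_distrib, hlin] at hsum
  have hs1 := sum_inv_sq_le m
  have hκ' : |κ * (∑ j ∈ Finset.range m, (U (1 + j) - 1 / 2) / ((j : ℝ) + 1) -
        ∑ j ∈ Finset.range m, (U (-(1 + j)) - 1 / 2) / ((j : ℝ) + 1))| ≤ 2 * C := by
    rw [abs_mul]
    refine (mul_le_of_le_one_left (abs_nonneg _) hκ).trans ((abs_sub _ _).trans ?_)
    linarith
  have a1 := abs_le.1 hsum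
  have a2 := abs_le.1 hκ'
  rw [abs_le]
  constructor <;> linarith

lemma exists_birkhoffRot_symLogRoof_approx {g : ℝ → ℝ} (hgper : Function.Periodic g 1)
    {Λ : ℝ} (hΛ0 : 0 ≤ Λ)
    (hΛ : ∀ x ∈ Set.Icc (-1 : ℝ) 2, ∀ y ∈ Set.Icc (-1 : ℝ) 2, |g x - g y| ≤ Λ * |x - y|)
    {α ε C : ℝ} {q : ℕ} (hq : 0 < q) {p r : ℤ} (hrp : (q : ℤ) ∣ p * r - 1)
    (hα : α = p / q + ε) (hε : (q : ℝ) ^ 2 * |ε| ≤ 1 / 100)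
    (h1 : ∀ s : ℤ, |∑ j ∈ Finset.range (q - 1),
        (Int.fract (((r * (1 + j : ℤ) + s : ℤ) : ℝ) / q) - 1 / 2) / ((j : ℝ) + 1)| ≤ C)
    (h2 : ∀ s : ℤ, |∑ j ∈ Finset.range (q - 1),
        (Int.fract (((-r * (1 + j : ℤ) + s : ℤ) : ℝ) / q) - 1 / 2) / ((j : ℝ) + 1)| ≤ C) :
    ∃ M : ℝ, ∀ x : ℝ, ∃ i < q, ∃ z : ℤ, |x + i * α - z| ≤ 3 / (5 * q) ∧
      |birkhoffRot α (symLogRoof g) q x - (M - Real.log (|x + i * α - z|))| ≤ 6 + 2 * C + Λ := by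
  have hqR : (0 : ℝ) < q := by exact_mod_cast hq
  have hqZ : (0 : ℤ) < q := by exact_mod_cast hq
  obtain ⟨m, rfl⟩ : ∃ m, q = m + 1 := ⟨q - 1, by omega⟩
  set q := m + 1 with hqm
  have hqc : (q : ℝ) = m + 1 := by rw [hqm]; push_cast; ring
  have hcop : IsCoprime r (q : ℤ) := by
    obtain ⟨w, hw⟩ := hrp
    exact ⟨p, -w, by linear_combination hw⟩
  refine ⟨∑ j ∈ Finset.range m, symLog (((j : ℝ) + 1) / (m + 1)) +
    ∑ c ∈ Finset.range q, g (c / q), fun x => ?_⟩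
  set t : ℤ := round (q * x) with ht
  set y : ℝ := q * x - t with hy
  have hy' : |y| ≤ 1 / 2 := abs_sub_round _
  -- `I c` is the time at which the orbit visits the grid point `c / q`
  set I : ℤ → ℤ := fun c => (r * c + -(r * t)) % q with hI
  set U : ℤ → ℝ := fun c => Int.fract (((r * c + -(r * t) : ℤ) : ℝ) / q) with hU
  have hIU : ∀ c, (I c : ℝ) = q * U c := by
    intro c
    simp only [hI, hU]
    have := Int.emod_add_mul_ediv (r * c + -(r * t)) q
    set v := r * c + -(r * t)
    have hv : (v : ℝ) = (v % q : ℤ) + q * (v / q : ℤ) := by exact_mod_cast this.symm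
    have e : (v : ℝ) / q = ((v % q : ℤ) : ℝ) / q + (v / q : ℤ) := by
      rw [hv]; field_simp
    rw [e, Int.fract_add_intCast, Int.fract_eq_self.2]
    · field_simp
    · have b1 : (0 : ℝ) ≤ (v % q : ℤ) := by exact_mod_cast Int.emod_nonneg v hqZ.ne'
      have b2 : ((v % q : ℤ) : ℝ) < q := by exact_mod_cast Int.emod_lt_of_pos v hqZ
      exact ⟨by positivity, by rwa [div_lt_one hqR]⟩
  have hI0 : ∀ c, 0 ≤ I c := fun c => Int.emod_nonneg _ hqZ.ne'
  have hIq : ∀ c, I c < q := fun c => Int.emod_lt_of_pos _ hqZ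
  set η : ℕ → ℝ := fun c => y / q + I c * ε with hη
  have hqη : ∀ c : ℕ, (q : ℝ) * η c = y + (q : ℝ) ^ 2 * ε * U c := by
    intro c
    simp only [hη]
    rw [hIU]
    field_simp
  have hκ : |(q : ℝ) ^ 2 * ε| ≤ 1 / 100 := by
    rw [abs_mul, abs_of_pos (by positivity)]; exact hε
  have hqη' : ∀ c : ℕ, |(q : ℝ) * η c| ≤ 3 / 5 := by
    intro c
    have hUa : |U c| ≤ 1 := by
      rw [abs_of_nonneg (Int.fract_nonneg _)]; exact (Int.fract_lt_one _).le
    have : |(q : ℝ) ^ 2 * ε * U c| ≤ 1 / 100 := by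
      rw [abs_mul]
      exact (mul_le_of_le_one_right (abs_nonneg _) hUa).trans hκ
    rw [hqη]
    exact (abs_add_le _ _).trans (by linarith)
  have hη' : ∀ c : ℕ, |η c| ≤ 3 / (5 * q) := by
    intro c
    have := hqη' c
    rw [abs_mul, abs_of_pos hqR] at this
    rw [le_div_iff₀ (by positivity)]
    linarith
  have horbit : ∀ c : ℕ, ∃ z : ℤ, x + I c * α = c / q + η c + z := by
    intro c
    have hd : (q : ℤ) ∣ t + p * I c - c := by
      have e1 : (q : ℤ) ∣ (r * c + -(r * t)) - I c :=
        Int.dvd_self_sub_emod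
      obtain ⟨w, hw⟩ := hrp
      obtain ⟨v, hv⟩ := e1
      exact ⟨w * (c - t) - p * v, by linear_combination (c - t : ℤ) * hw - p * hv⟩
    obtain ⟨z, hz⟩ := hd
    have hz' : (t : ℝ) + p * I c - c = q * z := by exact_mod_cast hz
    refine ⟨z, ?_⟩
    simp only [hη]
    have hx : x = (t + y) / q := by rw [hy]; field_simp; ring
    rw [hα, hx]
    field_simp
    linear_combination hz'
  have hbirk : birkhoffRot α (symLogRoof g) q x =
      ∑ c ∈ Finset.range q, symLogRoof g (c / q + η c) := by
    have := sum_range_emod_affine hq hcop (-(r * t)) (fun k => symLogRoof g (x + k * α))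
    rw [birkhoffRot]
    simp only [Int.cast_natCast] at this
    rw [← this]
    refine Finset.sum_congr rfl fun c _ => ?_
    obtain ⟨z, hz⟩ := horbit c
    change symLogRoof g (x + I c * α) = _
    rw [hz, symLogRoof, symLogRoof, symLog_add_intCast]
    congr 1
    simpa using hgper.int_mul z (c / q + η c)
  have hgsum : |∑ c ∈ Finset.range q, (g (c / q + η c) - g (c / q))| ≤ Λ := by
    have hb : ∀ c ∈ Finset.range q, |g (c / q + η c) - g (c / q)| ≤ Λ / q := by
      intro c hc
      have hc' : (c : ℝ) + 1 ≤ q := by exact_mod_cast Finset.mem_range.1 hc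
      have c0 : (0 : ℝ) ≤ c / q := by positivity
      have c1 : (c : ℝ) / q ≤ 1 := by rw [div_le_one hqR]; linarith
      have hq1 : (1 : ℝ) ≤ q := by exact_mod_cast hq
      have hηs : |η c| ≤ 1 / q := (hη' c).trans (by
        rw [div_le_div_iff₀ (by positivity) hqR]; linarith)
      have hη1 := abs_le.1 (hηs.trans (by rw [div_le_one hqR]; exact hq1))
      refine (hΛ _ ⟨by linarith, by linarith⟩ _ ⟨by linarith, by linarith⟩).trans ?_
      rw [add_sub_cancel_left, div_eq_mul_one_div]
      gcongr
    refine (Finset.abs_sum_le_sum_abs _ _).trans ((Finset.sum_le_card_nsmul _ _ _ hb).trans ?_)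
    rw [Finset.card_range, nsmul_eq_mul, mul_div_cancel₀ _ hqR.ne']
  have hUper : ∀ c : ℤ, U (c + (m + 1 : ℕ)) = U c := by
    intro c
    simp only [hU]
    rw [show (((r * (c + (m + 1 : ℕ)) + -(r * t) : ℤ) : ℝ)) / q =
      ((r * c + -(r * t) : ℤ) : ℝ) / q + r by
        rw [← hqm]; push_cast; field_simp; ring, Int.fract_add_intCast]
  have hgrid := abs_sum_symLog_perturbed_grid_sub_le (κ := (q : ℝ) ^ 2 * ε) (y := y) (η := η)
    hUper (h1 _) (by simpa only [hU, mul_neg, neg_mul, show q - 1 = m from rfl] using h2 (-(r * t))) (hκ.trans (by norm_num))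
    (fun j _ => by rw [← hqc, hqη]; push_cast; rw [add_comm (j : ℤ)])
    (fun j _ => by rw [← hqc]; exact hqη' _)
  obtain ⟨z, hz⟩ := horbit 0
  have hz0 : x + ((I 0).toNat : ℕ) * α - z = η 0 := by
    have : (((I 0).toNat : ℕ) : ℝ) = (I 0 : ℝ) := by
      exact_mod_cast Int.toNat_of_nonneg (hI0 0)
    rw [this]
    simp only [Nat.cast_zero, zero_div, zero_add] at hz
    rw [hz]; ring
  refine ⟨(I 0).toNat, by have := hI0 0; have := hIq 0; omega, z, ?_, ?_⟩
  · rw [hz0]; exact hη' 0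
  · have hq1 : (1 : ℝ) ≤ q := by exact_mod_cast hq
    have hlog := abs_le.1 (abs_symLog_add_log_le (η := η 0) ((hη' 0).trans (by
      rw [div_le_div_iff₀ (by positivity) (by norm_num)]; linarith)))
    have hsplit : ∑ c ∈ Finset.range q, symLogRoof g (c / q + η c) =
        ∑ j ∈ Finset.range m, symLog (((j : ℝ) + 1) / (m + 1) + η (j + 1)) + symLog (η 0) +
          ∑ c ∈ Finset.range q, g (c / q + η c) := by
      simp only [symLogRoof, Finset.sum_add_distrib]
      congr 1
      rw [hqm, Finset.sum_range_succ']
      simp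
    rw [hz0, hbirk, hsplit]
    rw [Finset.sum_sub_distrib] at hgrid hgsum
    have a1 := abs_le.1 hgrid
    have a2 := abs_le.1 hgsum
    rw [abs_le]
    constructor <;> linarith

/-- The numerators of the convergents of the continued fraction of `α`. -/
def cfP (α : ℝ) : ℕ → ℤ
  | 0 => 0
  | 1 => 1
  | n + 2 => cfA α (n + 2) * cfP α (n + 1) + cfP α n

lemma isDenSeq_cfQ (α : ℝ) : IsDenSeq (cfA α) (cfQ α) :=
  ⟨rfl, rfl, fun _ => rfl⟩

lemma gaussIter_succ (α : ℝ) (n : ℕ) : gaussIter α (n + 1) = Int.fract (gaussIter α n)⁻¹ := by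
  rw [gaussIter, Function.iterate_succ_apply', gaussIter]

lemma irrational_fract {x : ℝ} (h : Irrational x) : Irrational (Int.fract x) :=
  h.sub_intCast _

lemma irrational_gaussIter {α : ℝ} (h : Irrational α) (n : ℕ) : Irrational (gaussIter α n) := by
  induction n with
  | zero => exact irrational_fract h
  | succ n ih => rw [gaussIter_succ]; exact irrational_fract ih.inv

lemma gaussIter_pos {α : ℝ} (h : Irrational α) (n : ℕ) : 0 < gaussIter α n := by
  refine lt_of_le_of_ne ?_ (irrational_gaussIter h n).ne_zero.symm
  cases n with
  | zero => exact Int.fract_nonneg _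
  | succ n => rw [gaussIter_succ]; exact Int.fract_nonneg _

lemma gaussIter_lt_one (α : ℝ) (n : ℕ) : gaussIter α n < 1 := by
  cases n with
  | zero => exact Int.fract_lt_one _
  | succ n => rw [gaussIter_succ]; exact Int.fract_lt_one _

lemma cfA_succ_add_gaussIter {α : ℝ} (h : Irrational α) (n : ℕ) :
    (cfA α (n + 1) + gaussIter α (n + 1)) * gaussIter α n = 1 := by
  have hpos := gaussIter_pos h n
  have : (cfA α (n + 1) : ℝ) + gaussIter α (n + 1) = (gaussIter α n)⁻¹ := by
    rw [gaussIter_succ, cfA, Nat.add_sub_cancel,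
      natCast_floor_eq_intCast_floor (inv_pos.2 hpos).le, Int.floor_add_fract]
  rw [this, inv_mul_cancel₀ hpos.ne']

lemma one_le_cfA {α : ℝ} (h : Irrational α) (n : ℕ) : 1 ≤ cfA α n := by
  rw [cfA, Nat.one_le_floor_iff]
  exact (one_le_inv₀ (gaussIter_pos h _)).2 (gaussIter_lt_one α _).le

lemma cfQ_pos {α : ℝ} (h : Irrational α) : ∀ n, 0 < cfQ α n
  | 0 => Nat.one_pos
  | 1 => one_le_cfA h 1
  | n + 2 => by
    have := cfQ_pos h n
    rw [cfQ]
    omega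

lemma cfQ_le_succ {α : ℝ} (h : Irrational α) (n : ℕ) : cfQ α n ≤ cfQ α (n + 1) := by
  cases n with
  | zero => exact one_le_cfA h 1
  | succ n =>
    rw [cfQ]
    have := one_le_cfA h (n + 2)
    nlinarith

lemma cfP_mul_cfQ_sub (α : ℝ) (n : ℕ) :
    cfP α (n + 1) * cfQ α n - cfP α n * cfQ α (n + 1) = (-1) ^ n := by
  induction n with
  | zero => simp [cfP, cfQ]
  | succ n ih =>
    rw [cfP, cfQ, pow_succ, ← ih]
    push_cast
    ring

lemma cfQ_mul_sub_cfP {α : ℝ} (h : Irrational α) (hα : α ∈ Set.Ioo (0 : ℝ) 1) (n : ℕ) :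
    cfQ α (n + 1) * α - cfP α (n + 1) = -gaussIter α (n + 1) * (cfQ α n * α - cfP α n) := by
  have h0 : gaussIter α 0 = α := Int.fract_eq_self.2 ⟨hα.1.le, hα.2⟩
  induction n with
  | zero =>
    have := cfA_succ_add_gaussIter h 0
    rw [h0] at this
    simp only [cfP, cfQ]
    push_cast
    linear_combination this
  | succ n ih =>
    have := cfA_succ_add_gaussIter h (n + 1)
    rw [cfP, cfQ]
    push_cast
    linear_combination (-(cfA α (n + 2) : ℝ) - gaussIter α (n + 2)) * (-1) * ih -
      this * (cfQ α n * α - cfP α n)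

lemma abs_cfQ_mul_sub_cfP_mul {α : ℝ} (h : Irrational α) (hα : α ∈ Set.Ioo (0 : ℝ) 1) (n : ℕ) :
    |cfQ α n * α - cfP α n| * (cfQ α (n + 1) + cfQ α n * gaussIter α (n + 1)) = 1 := by
  induction n with
  | zero =>
    have h0 : gaussIter α 0 = α := Int.fract_eq_self.2 ⟨hα.1.le, hα.2⟩
    have := cfA_succ_add_gaussIter h 0
    rw [h0] at this
    simp only [cfP, cfQ]
    push_cast
    rw [one_mul, sub_zero, abs_of_pos hα.1]
    linear_combination this
  | succ n ih =>
    have := cfA_succ_add_gaussIter h (n + 1)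
    rw [cfQ_mul_sub_cfP h hα, abs_mul, abs_neg, abs_of_pos (gaussIter_pos h _), ← ih, cfQ]
    push_cast
    linear_combination |cfQ α n * α - cfP α n| * cfQ α (n + 1) * this

lemma abs_cfQ_mul_sub_cfP_le {α : ℝ} (h : Irrational α) (hα : α ∈ Set.Ioo (0 : ℝ) 1) (n : ℕ) :
    |cfQ α n * α - cfP α n| * cfQ α (n + 1) ≤ 1 := by
  rw [← abs_cfQ_mul_sub_cfP_mul h hα n]
  have := gaussIter_pos h (n + 1)
  gcongr
  exact le_add_of_nonneg_right (by positivity)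

lemma one_le_abs_cfQ_mul_sub_cfP {α : ℝ} (h : Irrational α) (hα : α ∈ Set.Ioo (0 : ℝ) 1) (n : ℕ) :
    1 ≤ |cfQ α n * α - cfP α n| * (2 * cfQ α (n + 1)) := by
  rw [← abs_cfQ_mul_sub_cfP_mul h hα n]
  have h1 := (gaussIter_lt_one α (n + 1)).le
  have h2 : (cfQ α n : ℝ) ≤ cfQ α (n + 1) := by exact_mod_cast cfQ_le_succ h n
  have h3 : (cfQ α n : ℝ) * gaussIter α (n + 1) ≤ cfQ α n * 1 := by gcongr
  gcongr
  linarith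

lemma exists_lipschitz_on_Icc {g : ℝ → ℝ} (hg : ContDiff ℝ 3 g) :
    ∃ Λ : ℝ, 0 ≤ Λ ∧
      ∀ x ∈ Set.Icc (-1 : ℝ) 2, ∀ y ∈ Set.Icc (-1 : ℝ) 2, |g x - g y| ≤ Λ * |x - y| := by
  obtain ⟨Λ, hΛ⟩ := (hg.of_le (m := 1) (by norm_num)).contDiffOn.exists_lipschitzOnWith
    (by norm_num) (convex_Icc (-1 : ℝ) 2) isCompact_Icc
  exact ⟨Λ, Λ.2, fun x hx y hy => by simpa [Real.dist_eq] using hΛ.dist_le_mul x hx y hy⟩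

/-- Away from the nearest singularity, a Birkhoff sum of length `q n` agrees up to a bounded error
with a constant depending on `n` only. -/
lemma exists_uniform_birkhoffRot_approx {α : ℝ} (h : Irrational α) (hα : α ∈ Set.Ioo (0 : ℝ) 1)
    {c : ℝ} (hc : 0 < c) {g : ℝ → ℝ} (hgper : Function.Periodic g 1) (hg : ContDiff ℝ 3 g) :
    ∃ C : ℝ, 0 ≤ C ∧ ∀ n : ℕ, 1 ≤ n →
      (∀ l, 1 ≤ l → l ≤ n → (cfA α (n + 1 - l) : ℝ) ≤ Real.exp (c * l)) →
      100 ≤ cfA α (n + 1) →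
      ∃ M : ℝ, ∀ x : ℝ, ∃ i < cfQ α n, ∃ z : ℤ, |x + i * α - z| ≤ 3 / (5 * cfQ α n) ∧
        |birkhoffRot α (symLogRoof g) (cfQ α n) x - (M - Real.log (|x + i * α - z|))| ≤ C := by
  obtain ⟨C, hC0, hC⟩ := (isDenSeq_cfQ α).exists_bound_sawtooth (fun n _ ↦ one_le_cfA h n) hc
  obtain ⟨Λ, hΛ0, hΛ⟩ := exists_lipschitz_on_Icc hg
  refine ⟨6 + 2 * C + Λ, by positivity, fun n _ hexp hA => ?_⟩
  obtain ⟨n, rfl⟩ : ∃ k, n = k + 1 := ⟨n - 1, by omega⟩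
  have hq := cfQ_pos h (n + 1)
  have hqR : (0 : ℝ) < cfQ α (n + 1) := by exact_mod_cast hq
  set q := cfQ α (n + 1) with hqdef
  set D : ℝ := q * α - cfP α (n + 1) with hD
  have hdet := cfP_mul_cfQ_sub α n
  obtain ⟨r, hr, hrp⟩ : ∃ r : ℤ, (r = cfQ α n ∨ r = -cfQ α n) ∧
      (q : ℤ) ∣ cfP α (n + 1) * r - 1 := by
    rcases neg_one_pow_eq_or ℤ n with hs | hs
    · exact ⟨_, Or.inl rfl, cfP α n, by linear_combination hdet + hs⟩
    · exact ⟨_, Or.inr rfl, -cfP α n, by linear_combination -hdet - hs⟩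
  have hε : (q : ℝ) ^ 2 * |D / q| ≤ 1 / 100 := by
    have h1 := abs_cfQ_mul_sub_cfP_le h hα (n + 1)
    have h2 : (100 : ℝ) * q ≤ cfQ α (n + 1 + 1) := by
      rw [cfQ]
      have : 100 * q ≤ cfA α (n + 1 + 1) * q := Nat.mul_le_mul_right _ hA
      exact_mod_cast this.trans (Nat.le_add_right _ _)
    have h3 := mul_le_mul_of_nonneg_left h2 (abs_nonneg D)
    rw [abs_div, abs_of_pos hqR]
    field_simp
    linarith
  have hs := hC (n + 1) hq hexp
  rw [Nat.add_sub_cancel] at hs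
  refine exists_birkhoffRot_symLogRoof_approx hgper hΛ0 hΛ hq hrp (by rw [hD]; field_simp; ring) hε
    (hs r hr) (hs (-r) ?_)
  rcases hr with rfl | rfl
  · exact Or.inr rfl
  · exact Or.inl (neg_neg _)

lemma mul_abs_le_exp_of_le_abs_sub {S S' M C b q η η' : ℝ} (hq : 0 < q)
    (hη : q * |η| ≤ 1) (hη' : q * |η'| ≤ 1) (hη'0 : 1 / 3 ≤ q * |η'|)
    (h : |S - (M - Real.log (|η|))| ≤ C) (h' : |S' - (M - Real.log (|η'|))| ≤ C)
    (hb : b ≤ |S - S'|) : q * |η| ≤ Real.exp (2 * C + 2 - b) := by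
  rcases (abs_nonneg η).eq_or_lt' with h0 | h0
  · rw [h0, mul_zero]; positivity
  have hη'pos : 0 < |η'| := by
    by_contra hcon
    have : q * |η'| ≤ 0 := mul_nonpos_of_nonneg_of_nonpos hq.le (not_lt.1 hcon)
    linarith
  have hl := Real.log_nonpos (by positivity) hη
  have hl' := Real.log_nonpos (by positivity) hη'
  have hl'' := Real.one_sub_inv_le_log_of_pos (x := q * |η'|) (by positivity)
  have hinv : (q * |η'|)⁻¹ ≤ 3 := by
    rw [inv_le_comm₀ (by positivity) (by norm_num)]; linarith
  rw [← Real.log_le_iff_le_exp (by positivity)]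
  rw [Real.log_mul hq.ne' h0.ne'] at hl ⊢
  rw [Real.log_mul hq.ne' hη'pos.ne'] at hl' hl''
  have a1 := abs_le.1 h
  have a2 := abs_le.1 h'
  rcases le_abs.1 hb with hb | hb <;> linarith

lemma natCast_sq_mul_cfQ_le {α : ℝ} {n L : ℕ} (h : 100 * L ^ 2 ≤ cfA α (n + 2)) :
    100 * (L : ℝ) ^ 2 * cfQ α (n + 1) ≤ cfQ α (n + 2) := by
  rw [cfQ]
  have := (Nat.mul_le_mul_right (cfQ α (n + 1)) h).trans (Nat.le_add_right _ (cfQ α n))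
  exact_mod_cast this

lemma cfQ_succ_le {α : ℝ} (hirr : Irrational α) {n B : ℕ} (h : cfA α (n + 2) < B) :
    cfQ α (n + 2) ≤ B * cfQ α (n + 1) := by
  rw [cfQ]
  have h1 := cfQ_le_succ hirr n
  have h2 := Nat.mul_le_mul_right (cfQ α (n + 1)) (Nat.succ_le_of_lt h)
  rw [Nat.succ_mul] at h2
  omega

lemma one_third_le_mul_abs_half_add {α D q : ℝ} {p z : ℤ} {i Q : ℕ} (hQ : q = Q) (hq : 0 < q)
    (hα : q * α = p + D) (hD : q * |D| ≤ 1 / 100) (hi : i < Q) :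
    1 / 3 ≤ q * |1 / (2 * q) + i * α - z| := by
  have hi' : (i : ℝ) ≤ q := by rw [hQ]; exact_mod_cast hi.le
  have hodd : (1 : ℝ) ≤ |((1 + 2 * (i * p - z * Q) : ℤ) : ℝ)| := by
    have : (1 : ℤ) ≤ |1 + 2 * (i * p - z * Q)| := by
      apply Int.one_le_abs
      omega
    exact_mod_cast this
  have hiD : |(i : ℝ) * D| ≤ 1 / 100 := by
    rw [abs_mul, Nat.abs_cast]
    exact (mul_le_mul_of_nonneg_right hi' (abs_nonneg D)).trans hD
  have e : q * (1 / (2 * q) + i * α - z) = ((1 + 2 * (i * p - z * Q) : ℤ) : ℝ) / 2 + i * D := by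
    have : q * (1 / (2 * q)) = 1 / 2 := by field_simp
    push_cast
    rw [← hQ]
    linear_combination this + i * hα
  rw [← abs_of_pos hq, ← abs_mul, abs_of_pos hq, e]
  have h1 := abs_sub_abs_le_abs_add (((1 + 2 * (i * p - z * Q) : ℤ) : ℝ) / 2) (i * D)
  rw [abs_div, abs_two] at h1
  linarith

/-- If two orbit points at times below `Q`, starting from `x` and from its translate by `m Q α`,
are both very close to integers, then a contradiction arises from `Q α` being neither too close
nor too far from an integer. -/
lemma not_both_close {α D q x τ B : ℝ} {p z z' w m : ℤ} {i i' Q : ℕ} {L : ℕ}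
    (hQ : q = Q) (hq : 0 < q) (hcop : IsCoprime p Q) (hα : q * α = p + D)
    (hm0 : m ≠ 0) (hm : |m| ≤ L) (hD : 100 * (L : ℝ) ^ 2 * (q * |D|) ≤ 1)
    (hD' : 1 ≤ q * |D| * (2 * B)) (hB : 200 ≤ B) (hτ : τ * (8 * B) ≤ 1)
    (hi : i < Q) (hi' : i' < Q)
    (h : q * |x + m * Q * α - w + i * α - z| ≤ τ) (h' : q * |x + i' * α - z'| ≤ τ) : False := by
  have hqD : 0 ≤ q * |D| := by positivity
  have hm1 : (1 : ℝ) ≤ |(m : ℝ)| := by exact_mod_cast Int.one_le_abs hm0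
  have hmL : |(m : ℝ)| ≤ L := by exact_mod_cast hm
  have hL1 : (1 : ℝ) ≤ L := hm1.trans hmL
  have hqD1 : q * |D| ≤ 1 / 100 := by
    linarith [le_mul_of_one_le_left hqD (one_le_pow₀ hL1 (n := 2))]
  have hmD : |m * (q * D)| ≤ 1 / 100 := by
    rw [abs_mul, abs_mul, abs_of_pos hq]
    calc |(m : ℝ)| * (q * |D|) ≤ L ^ 2 * (q * |D|) := by
          gcongr
          nlinarith
      _ ≤ 1 / 100 := by linarith
  have hmD' : q * |D| ≤ |m * (q * D)| := by
    rw [abs_mul, abs_mul, abs_of_pos hq]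
    exact le_mul_of_one_le_left hqD hm1
  have hiR : (i : ℝ) < q := by rw [hQ]; exact_mod_cast hi
  have hiR' : (i' : ℝ) < q := by rw [hQ]; exact_mod_cast hi'
  have hi0 : (0 : ℝ) ≤ i := Nat.cast_nonneg i
  have hi0' : (0 : ℝ) ≤ i' := Nat.cast_nonneg i'
  have hiD : |((i : ℝ) - i') * D| ≤ 1 / 100 := by
    rw [abs_mul]
    refine le_trans (mul_le_mul_of_nonneg_right ?_ (abs_nonneg D)) hqD1
    rw [abs_le]; constructor <;> linarith
  have hτB : τ ≤ 1 / (8 * B) := by rwa [le_div_iff₀ (by linarith)]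
  have hτ1 : 1 / (8 * B) ≤ 1 / 1600 := one_div_le_one_div_of_le (by norm_num) (by linarith)
  set N : ℤ := (i - i') * p + Q * (m * p - w - z + z') with hN
  have hdiff : (N : ℝ) + m * (q * D) + (i - i') * D =
      q * (x + m * Q * α - w + i * α - z) - q * (x + i' * α - z') := by
    rw [hN]
    push_cast
    rw [← hQ]
    linear_combination (-(m : ℝ) * q - i + i') * hα
  have hsmall : |(N : ℝ) + m * (q * D) + (i - i') * D| ≤ 2 * τ := by
    rw [hdiff]
    refine (abs_sub _ _).trans ?_
    rw [abs_mul, abs_mul, abs_of_pos hq]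
    linarith
  have hN0 : N = 0 := by
    rw [← Int.abs_lt_one_iff]
    have : |(N : ℝ)| < 1 := by
      have a1 := abs_le.1 hsmall
      have a2 := abs_le.1 hmD
      have a3 := abs_le.1 hiD
      rw [abs_lt]; constructor <;> linarith
    exact_mod_cast this
  have hdvd : (Q : ℤ) ∣ (i : ℤ) - i' := by
    refine hcop.symm.dvd_of_dvd_mul_right ?_
    exact ⟨-(m * p - w - z + z'), by linear_combination hN0 - hN⟩
  have hii : (i : ℤ) - i' = 0 :=
    Int.eq_zero_of_abs_lt_dvd hdvd (by rw [abs_lt]; constructor <;> omega)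
  have hiiR : (i : ℝ) - i' = 0 := by exact_mod_cast hii
  rw [hN0, hiiR, Int.cast_zero, zero_add, zero_mul, add_zero] at hsmall
  have : 1 / (2 * B) ≤ q * |D| := by rwa [div_le_iff₀ (by linarith)]
  have e1 : 1 / (2 * B) = 4 * (1 / (8 * B)) := by field_simp; norm_num
  have e2 : 0 < 1 / (8 * B) := by positivity
  linarith

/-- For `α ∈ 𝒞_{K,L}` (`L > K`) with associated sequence `(n_k)` and
`f(x) = -log x - log(1-x) + g(x)` (`g ∈ C³(𝕋)`, `g > 0`), there are `k₀` and `b₀ > 0` such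
that for all `k ≥ k₀`, `b ≥ b₀` and `i ∈ {-L,…,-1,1,…,L}`:
`A_k(b) ∩ R_α^{i q_{n_k}}(A_k(b/(2L))) = ∅`. -/
theorem statement11 (K L : ℕ) (hKL : K < L)
    (α : ℝ) (hirr : Irrational α) (hα : α ∈ Set.Ioo (0 : ℝ) 1)
    (nk : ℕ → ℕ) (hnk : StrictMono nk) (c : ℝ) (hc : 0 < c)
    (hdio1 : ∀ k n : ℕ, 1 ≤ n → n ≤ nk k →
      (cfA α (nk k + 1 - n) : ℝ) ≤ Real.exp (c * n))
    (hdio2 : ∀ k : ℕ, 100 * (K ^ 2 + L ^ 2) < cfA α (nk k + 1) ∧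
      cfA α (nk k + 1) < 200 * (K ^ 2 + L ^ 2))
    (g : ℝ → ℝ) (hgper : Function.Periodic g 1) (hg : ContDiff ℝ 3 g) (hgpos : ∀ x, 0 < g x) :
    ∃ k₀ : ℕ, ∃ b₀ > (0 : ℝ), ∀ k ≥ k₀, ∀ b ≥ b₀, ∀ i : ℤ, i ≠ 0 → |i| ≤ (L : ℤ) →
      AkSet α g (cfQ α (nk k)) b ∩
        ((fun x : ℝ => Int.fract (x + ((i * (cfQ α (nk k) : ℤ) : ℤ) : ℝ) * α)) ''
          AkSet α g (cfQ α (nk k)) (b / (2 * (L : ℝ)))) = ∅ := by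
  obtain ⟨C, hC0, hC⟩ := exists_uniform_birkhoffRot_approx hirr hα hc hgper hg
  set B : ℝ := 200 * ((K : ℝ) ^ 2 + (L : ℝ) ^ 2) with hB
  have hL1 : (1 : ℝ) ≤ L := by exact_mod_cast (by omega : 1 ≤ L)
  have hB200 : 200 ≤ B := by nlinarith [sq_nonneg (K : ℝ)]
  have hlogB : 0 ≤ Real.log (8 * B) := Real.log_nonneg (by linarith)
  refine ⟨1, 2 * L * (2 * C + 2 + Real.log (8 * B)), by positivity, ?_⟩
  intro k hk b hb m hm0 hm
  rw [Set.eq_empty_iff_forall_notMem]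
  rintro _ ⟨⟨_, hx⟩, x, ⟨_, hx'⟩, rfl⟩
  have hn : 1 ≤ nk k := hk.trans (hnk.id_le k)
  obtain ⟨hA1, hA2⟩ := hdio2 k
  have hexp := hdio1 k
  obtain ⟨n, hnn⟩ : ∃ n, nk k = n + 1 := ⟨nk k - 1, by omega⟩
  rw [hnn] at hx hx' hA1 hA2 hexp
  have hL2 : 100 * L ^ 2 ≤ cfA α (n + 2) :=
    le_trans (Nat.mul_le_mul_left _ (Nat.le_add_left _ _)) hA1.le
  have hqR : (0 : ℝ) < cfQ α (n + 1) := by exact_mod_cast cfQ_pos hirr (n + 1)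
  obtain ⟨M, hM⟩ := hC (n + 1) (by omega) hexp
    (le_trans (by nlinarith [show 1 ≤ L by omega]) hL2)
  set q : ℝ := (cfQ α (n + 1) : ℝ) with hq
  set D : ℝ := q * α - cfP α (n + 1) with hD
  have hlow := natCast_sq_mul_cfQ_le hL2
  have hup : (cfQ α (n + 2) : ℝ) ≤ B * q := by
    have := cfQ_succ_le hirr hA2
    rw [hB, hq]
    exact_mod_cast this
  have hD1 : 100 * (L : ℝ) ^ 2 * (q * |D|) ≤ 1 := by
    have h1 := abs_cfQ_mul_sub_cfP_le hirr hα (n + 1)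
    have h2 := mul_le_mul_of_nonneg_left hlow (abs_nonneg D)
    linarith
  have hD2 : 1 ≤ q * |D| * (2 * B) := by
    have h1 := one_le_abs_cfQ_mul_sub_cfP hirr hα (n + 1)
    have h2 := mul_le_mul_of_nonneg_left hup (abs_nonneg D)
    linarith
  have hD3 : q * |D| ≤ 1 / 100 := by
    have : 0 ≤ q * |D| := by positivity
    linarith [le_mul_of_one_le_left this (one_le_pow₀ hL1 (n := 2))]
  have hαD : q * α = cfP α (n + 1) + D := by rw [hD]; ring
  have hone : ∀ t : ℝ, t ≤ 3 / (5 * q) → q * t ≤ 1 := by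
    intro t ht
    have := mul_le_mul_of_nonneg_left ht hqR.le
    rw [show q * (3 / (5 * q)) = 3 / 5 by field_simp] at this
    linarith
  obtain ⟨j, hj, w, hw, happ⟩ := hM (1 / (2 * q))
  have hthird := one_third_le_mul_abs_half_add (z := w) hq hqR hαD hD3 hj
  obtain ⟨i, hi, z, hz, hiapp⟩ :=
    hM (Int.fract (x + ((m * (cfQ α (n + 1) : ℤ) : ℤ) : ℝ) * α))
  obtain ⟨i', hi', z', hz', hiapp'⟩ := hM x
  have hbL : 2 * C + 2 + Real.log (8 * B) ≤ b / (2 * L) := by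
    rw [le_div_iff₀ (by positivity)]; linarith
  have hbb : b / (2 * L) ≤ b := by
    apply div_le_self
    · exact le_trans (by positivity) hb
    · linarith
  have c1 := mul_abs_le_exp_of_le_abs_sub hqR (hone _ hz) (hone _ hw) hthird hiapp happ
    (hbb.trans hx)
  have c2 := mul_abs_le_exp_of_le_abs_sub hqR (hone _ hz') (hone _ hw) hthird hiapp' happ hx'
  have hτ : Real.exp (2 * C + 2 - b / (2 * L)) * (8 * B) ≤ 1 := by
    have h8 : 0 < 8 * B := by linarith
    calc _ ≤ Real.exp (-Real.log (8 * B)) * (8 * B) := by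
          gcongr
          linarith
      _ = 1 := by rw [Real.exp_neg, Real.exp_log h8, inv_mul_cancel₀ h8.ne']
  have hcop : IsCoprime (cfP α (n + 1)) (cfQ α (n + 1) : ℤ) := by
    have hdet := cfP_mul_cfQ_sub α n
    have h1 : ((-1 : ℤ) ^ n) * (-1) ^ n = 1 := by rw [← mul_pow]; norm_num
    exact ⟨(-1) ^ n * cfQ α n, -(-1) ^ n * cfP α n, by linear_combination (-1) ^ n * hdet + h1⟩
  rw [Int.fract] at c1
  push_cast at c1
  exact not_both_close hq hqR hcop hαD hm0 hm hD1 hD2 hB200 hτ hi hi' c1 c2
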